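/- The function $t \mapsto \Delta(ie^t)$ is a Schwartz function on $\mathbb{R}$: $\Delta(ie^t)$ and all its derivatives decay faster than any polynomial as $t \to \pm\infty$. In particular $\Delta(ie^t) = O(e^{-2\pi e^t})$ as $t\to+\infty$ and $\Delta(ie^t) = O(e^{12|t|}e^{-2\pi e^{|t|}})$ as $t\to-\infty$. -/

import Mathlib

open Filter

/-- The modular discriminant on the imaginary axis,
`Δ(ix) = e^{-2πx} ∏_{n ≥ 1} (1 - e^{-2πnx})^{24}` for `x > 0`. -/
noncomputable def DeltaFn (x : ℝ) : ℝ :=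
  Real.exp (-2 * Real.pi * x) * ∏' n : ℕ+, (1 - Real.exp (-2 * Real.pi * (n : ℕ) * x)) ^ 24

section ModularDiscriminant

open Complex hiding eta
open ModularForm
open UpperHalfPlane hiding I

lemma sqrt_pow_twentyFour {z : ℂ} (hz : z ≠ 0) : sqrt z ^ 24 = z ^ 12 := by
  rw [sqrt_eq_exp hz, ← exp_nat_mul,
    show ((24 : ℕ) : ℂ) * (log z / 2) = (12 : ℕ) * log z by push_cast; ring,
    exp_nat_mul, exp_log hz]

/-- The transformation formula `η(-1/z)^24 = z^12 η(z)^24`. -/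
lemma eta_pow_twentyFour_neg_inv {z : ℂ} (hz : 0 < z.im) :
    eta (-1 / z) ^ 24 = z ^ 12 * eta z ^ 24 := by
  have h := eta_comp_eq_csqrt_I_inv (show z ∈ upperHalfPlaneSet from hz)
  have hz0 : z ≠ 0 := by rintro rfl; simp at hz
  simp only [Function.comp_apply, Pi.smul_apply, Pi.mul_apply, smul_eq_mul] at h
  rw [h, mul_pow, mul_pow, inv_pow, sqrt_pow_twentyFour I_ne_zero, sqrt_pow_twentyFour hz0,
    show (12 : ℕ) = 4 * 3 by norm_num, pow_mul I, I_pow_four]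
  simp

/-- Near the cusp `i∞`, `η ^ 24` decays like `q = e^{2πiz}`. -/
lemma exists_norm_eta_pow_twentyFour_le {c : ℝ} (hc : 0 < c) :
    ∃ C : ℝ, ∀ z : ℂ, c ≤ z.im →
      ‖eta z ^ 24‖ ≤ C * Real.exp (-2 * Real.pi * z.im) := by
  have hr : Real.exp (-2 * Real.pi * c) < 1 := by
    rw [Real.exp_lt_one_iff]
    nlinarith [mul_pos Real.pi_pos hc]
  obtain ⟨C, hC⟩ := (isCompact_closedBall (0 : ℂ)
    (Real.exp (-2 * Real.pi * c))).exists_bound_of_continuousOn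
    ((differentiableOn_tprod_one_sub_pow_pow 24).continuousOn.mono
      (Metric.closedBall_subset_ball hr))
  refine ⟨C, fun z hz ↦ ?_⟩
  have hz0 : 0 < z.im := hc.trans_le hz
  have hq : ‖Function.Periodic.qParam 1 z‖ = Real.exp (-2 * Real.pi * z.im) := by
    rw [Function.Periodic.norm_qParam, div_one]
  have h := discriminant_eq_q_prod ⟨z, hz0⟩
  simp only [discriminant] at h
  rw [h, norm_mul, hq, mul_comm]
  gcongr
  apply hC
  rw [mem_closedBall_zero_iff, hq, Real.exp_le_exp]
  nlinarith [Real.pi_pos]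

/-- `DeltaFn` is the restriction of `η ^ 24` to the imaginary axis. -/
lemma ofReal_deltaFn {x : ℝ} (hx : 0 < x) : (DeltaFn x : ℂ) = eta (I * x) ^ 24 := by
  have h := discriminant_eq_q_prod ⟨I * x, by simpa using hx⟩
  simp only [discriminant] at h
  rw [h, DeltaFn, ofReal_mul,
    tprod_pnat_eq_tprod_succ (f := fun n : ℕ ↦ (1 - Real.exp (-2 * Real.pi * n * x)) ^ 24)]
  have key := Complex.isometry_ofReal.isClosedEmbedding.map_tprod
    (fun n : ℕ ↦ (1 - Real.exp (-2 * Real.pi * (n + 1 : ℕ) * x)) ^ 24)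
    (g := Complex.ofRealHom) (L := .unconditional _)
  simp only [ofRealHom_eq_coe] at key
  rw [key]
  congr 1
  · simp only [Function.Periodic.qParam, ofReal_exp]
    congr 1
    push_cast
    linear_combination (-2 * Real.pi * x : ℂ) * I_sq
  · congr 1 with n
    rw [eta_q_eq_cexp]
    push_cast
    congr 3
    linear_combination (-2 * Real.pi * x * (n + 1) : ℂ) * I_sq

/-- The function `w ↦ Δ(i eʷ)`. -/
noncomputable def discriminantExp (w : ℂ) : ℂ := eta (I * exp w) ^ 24

lemma im_I_mul_exp (w : ℂ) : (I * exp w).im = Real.exp w.re * Real.cos w.im := by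
  simp [exp_re]

lemma discriminantExp_ofReal (t : ℝ) : discriminantExp t = DeltaFn (Real.exp t) := by
  rw [ofReal_deltaFn (Real.exp_pos t), discriminantExp, ofReal_exp]

lemma analyticOnNhd_discriminantExp :
    AnalyticOnNhd ℂ discriminantExp {w | 0 < Real.cos w.im} := by
  refine DifferentiableOn.analyticOnNhd (fun w hw ↦ ?_)
    (isOpen_lt continuous_const (Real.continuous_cos.comp continuous_im))
  have hw' : I * exp w ∈ upperHalfPlaneSet := by
    change 0 < (I * exp w).im
    rw [im_I_mul_exp]
    exact mul_pos (Real.exp_pos _) hw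
  exact (((differentiableAt_eta_of_mem_upperHalfPlaneSet hw').comp w
    (by fun_prop : DifferentiableAt ℂ (fun w ↦ I * exp w) w)).pow 24).differentiableWithinAt

lemma discriminantExp_neg {w : ℂ} (hw : 0 < Real.cos w.im) :
    discriminantExp (-w) = exp (12 * w) * discriminantExp w := by
  have him : 0 < (I * exp w).im := by
    rw [im_I_mul_exp]
    exact mul_pos (Real.exp_pos _) hw
  have h := eta_pow_twentyFour_neg_inv him
  have h1 : -1 / (I * exp w) = I * exp (-w) := by
    rw [exp_neg, div_eq_iff (mul_ne_zero I_ne_zero (exp_ne_zero w))]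
    field_simp [exp_ne_zero w]
    rw [I_sq]
  rw [h1] at h
  rw [discriminantExp, discriminantExp, h, mul_pow, show (12 : ℕ) = 4 * 3 by norm_num, pow_mul I,
    I_pow_four, ← exp_nat_mul]
  norm_num

/-- `|Δ(i eʷ)|` decays doubly exponentially in a horizontal strip. -/
lemma exists_norm_discriminantExp_le :
    ∃ C : ℝ, ∀ w : ℂ, 1 / 2 ≤ Real.cos w.im →
      (0 ≤ w.re → ‖discriminantExp w‖ ≤
        C * Real.exp (-2 * Real.pi * (Real.exp w.re * Real.cos w.im))) ∧
      (w.re ≤ 0 → ‖discriminantExp w‖ ≤ C * (Real.exp (12 * |w.re|) *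
        Real.exp (-2 * Real.pi * (Real.exp |w.re| * Real.cos w.im)))) := by
  obtain ⟨C, hC⟩ := exists_norm_eta_pow_twentyFour_le (c := 1 / 2) (by norm_num)
  have pos : ∀ w : ℂ, 1 / 2 ≤ Real.cos w.im → 0 ≤ w.re → ‖discriminantExp w‖ ≤
      C * Real.exp (-2 * Real.pi * (Real.exp w.re * Real.cos w.im)) := fun w hw h0 ↦ by
    rw [← im_I_mul_exp]
    refine hC _ ?_
    rw [im_I_mul_exp]
    nlinarith [Real.one_le_exp h0]
  refine ⟨C, fun w hw ↦ ⟨pos w hw, fun h0 ↦ ?_⟩⟩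
  have hw' : 1 / 2 ≤ Real.cos (-w).im := by simpa using hw
  have h1 := pos (-w) hw' (by simpa using h0)
  have h2 := discriminantExp_neg (w := -w) (by linarith)
  rw [neg_neg] at h2
  rw [h2, norm_mul, norm_exp, abs_of_nonpos h0]
  calc _ ≤ _ := mul_le_mul_of_nonneg_left h1 (Real.exp_pos _).le
    _ = _ := by simp; ring

lemma exists_norm_discriminantExp_le_exp_neg_abs :
    ∃ C : ℝ, ∀ w : ℂ, 1 / 2 ≤ Real.cos w.im → ‖discriminantExp w‖ ≤ C * Real.exp (-|w.re|) := by
  obtain ⟨C, hC⟩ := exists_norm_discriminantExp_le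
  have hC0 : 0 ≤ C := by
    have := (norm_nonneg _).trans ((hC 0 (by norm_num)).1 le_rfl)
    exact nonneg_of_mul_nonneg_left this (Real.exp_pos _)
  refine ⟨C * Real.exp 30, fun w hw ↦ ?_⟩
  have hs := abs_nonneg w.re
  have hquad := Real.quadratic_le_exp_of_nonneg hs
  have hbound : 12 * |w.re| + -2 * Real.pi * (Real.exp |w.re| * Real.cos w.im) ≤
      30 + -|w.re| := by
    have h1 : Real.exp |w.re| * (1 / 2) ≤ Real.exp |w.re| * Real.cos w.im := by gcongr
    have h2 : 3 * Real.exp |w.re| ≤ Real.pi * Real.exp |w.re| := by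
      gcongr
      exact Real.pi_gt_three.le
    nlinarith [mul_le_mul_of_nonneg_left h1 Real.pi_pos.le, sq_nonneg (|w.re| - 4)]
  rw [mul_assoc, ← Real.exp_add]
  rcases le_total 0 w.re with h0 | h0
  · refine ((hC w hw).1 h0).trans ?_
    rw [abs_of_nonneg h0] at *
    gcongr
    linarith
  · refine ((hC w hw).2 h0).trans ?_
    rw [← Real.exp_add]
    gcongr

lemma iteratedDeriv_re_ofReal {F : ℂ → ℂ} (hF : ∀ t : ℝ, AnalyticAt ℂ F t) (n : ℕ) :
    iteratedDeriv n (fun t : ℝ ↦ (F t).re) = fun t : ℝ ↦ (iteratedDeriv n F t).re := by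
  induction n with
  | zero => simp
  | succ n ih =>
    ext t
    rw [iteratedDeriv_succ, ih, iteratedDeriv_succ]
    refine (HasDerivAt.real_of_complex ?_).deriv
    rw [iteratedDeriv_eq_iterate]
    exact ((hF t).iterated_deriv n).differentiableAt.hasDerivAt

lemma half_le_cos_of_abs_le_half {y : ℝ} (hy : |y| ≤ 1 / 2) : 1 / 2 ≤ Real.cos y := by
  nlinarith [Real.one_sub_sq_div_two_le_cos (x := y), abs_le.mp hy]

lemma exists_norm_iteratedDeriv_discriminantExp_le (n : ℕ) :
    ∃ C : ℝ, ∀ t : ℝ, ‖iteratedDeriv n discriminantExp t‖ ≤ C * Real.exp (-|t|) := by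
  obtain ⟨C, hC⟩ := exists_norm_discriminantExp_le_exp_neg_abs
  have hC0 : 0 ≤ C := by
    have := (norm_nonneg _).trans (hC 0 (by norm_num))
    exact nonneg_of_mul_nonneg_left this (Real.exp_pos _)
  refine ⟨n.factorial * (C * Real.exp (1 / 2)) / (1 / 2) ^ n, fun t ↦ ?_⟩
  have hcos : ∀ w ∈ Metric.closedBall (t : ℂ) (1 / 2), 1 / 2 ≤ Real.cos w.im := fun w hw ↦ by
    rw [mem_closedBall_iff_norm] at hw
    refine half_le_cos_of_abs_le_half (le_trans ?_ hw)
    simpa using abs_im_le_norm (w - t)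
  have hdiff : DiffContOnCl ℂ discriminantExp (Metric.ball (t : ℂ) (1 / 2)) := by
    refine DifferentiableOn.diffContOnCl fun w hw ↦ ?_
    have := hcos w (Metric.closure_ball_subset_closedBall hw)
    exact (analyticOnNhd_discriminantExp w (show 0 < Real.cos w.im by
      linarith)).differentiableAt.differentiableWithinAt
  refine (norm_iteratedDeriv_le_of_forall_mem_sphere_norm_le n (by norm_num) hdiff
    (C := C * Real.exp (1 / 2) * Real.exp (-|t|)) fun w hw ↦ ?_).trans_eq (by ring)
  refine (hC w (hcos w (Metric.sphere_subset_closedBall hw))).trans ?_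
  rw [mul_assoc, ← Real.exp_add]
  gcongr
  have h1 : |t - w.re| ≤ 1 / 2 := by
    rw [abs_sub_comm, ← mem_sphere_iff_norm.mp hw]
    simpa using abs_re_le_norm (w - t)
  linarith [abs_sub_abs_le_abs_sub t w.re]

lemma analyticAt_discriminantExp_ofReal (t : ℝ) : AnalyticAt ℂ discriminantExp t :=
  analyticOnNhd_discriminantExp t (by simp)

lemma deltaFn_exp_eq_re :
    (fun t : ℝ ↦ DeltaFn (Real.exp t)) = fun t : ℝ ↦ (discriminantExp t).re := by
  ext t
  rw [discriminantExp_ofReal, ofReal_re]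

lemma norm_deltaFn_exp (t : ℝ) : ‖DeltaFn (Real.exp t)‖ = ‖discriminantExp t‖ := by
  rw [discriminantExp_ofReal, norm_real]

/-- `t ↦ Δ(i eᵗ)` as a Schwartz function. -/
noncomputable def deltaExpSchwartz : SchwartzMap ℝ ℝ where
  toFun t := DeltaFn (Real.exp t)
  smooth' := by
    rw [deltaFn_exp_eq_re, contDiff_iff_contDiffAt]
    exact fun t ↦ (analyticAt_discriminantExp_ofReal t).contDiffAt.real_of_complex
  decay' k n := by
    obtain ⟨C, hC⟩ := exists_norm_iteratedDeriv_discriminantExp_le n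
    refine ⟨k.factorial * C, fun t ↦ ?_⟩
    rw [norm_iteratedFDeriv_eq_norm_iteratedDeriv, deltaFn_exp_eq_re,
      iteratedDeriv_re_ofReal analyticAt_discriminantExp_ofReal, Real.norm_eq_abs, Real.norm_eq_abs]
    have h1 : |t| ^ k ≤ k.factorial * Real.exp |t| :=
      (div_le_iff₀' (by positivity)).mp (Real.pow_div_factorial_le_exp _ (abs_nonneg t) k)
    calc |t| ^ k * |(iteratedDeriv n discriminantExp t).re|
        ≤ (k.factorial * Real.exp |t|) * (C * Real.exp (-|t|)) := by
          gcongr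
          exact (abs_re_le_norm _).trans (hC t)
      _ = k.factorial * C * Real.exp (|t| + -|t|) := by rw [Real.exp_add]; ring
      _ = k.factorial * C := by simp

end ModularDiscriminant

/-- `t ↦ Δ(i eᵗ)` is a Schwartz function on `ℝ`; in particular
`Δ(i eᵗ) = O(e^{-2π eᵗ})` as `t → +∞` and `Δ(i eᵗ) = O(e^{12|t|} e^{-2π e^{|t|}})`
as `t → -∞`. -/
theorem delta_exp_schwartz :
    (∃ g : SchwartzMap ℝ ℝ, ∀ t : ℝ, g t = DeltaFn (Real.exp t)) ∧
    (fun t : ℝ => DeltaFn (Real.exp t)) =O[atTop]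
      (fun t : ℝ => Real.exp (-2 * Real.pi * Real.exp t)) ∧
    (fun t : ℝ => DeltaFn (Real.exp t)) =O[atBot]
      (fun t : ℝ => Real.exp (12 * |t|) * Real.exp (-2 * Real.pi * Real.exp |t|)) := by
  obtain ⟨C, hC⟩ := exists_norm_discriminantExp_le
  refine ⟨⟨deltaExpSchwartz, fun _ ↦ rfl⟩, .of_bound C ?_, .of_bound C ?_⟩
  · filter_upwards [eventually_ge_atTop 0] with t ht
    rw [norm_deltaFn_exp, Real.norm_of_nonneg (Real.exp_pos _).le]
    simpa using (hC t (by norm_num)).1 (by simpa using ht)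
  · filter_upwards [eventually_le_atBot 0] with t ht
    rw [norm_deltaFn_exp, Real.norm_of_nonneg (by positivity)]
    simpa using (hC t (by norm_num)).2 (by simpa using ht)
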